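/- For all integers k ≥ 1 and all integers i, j with 0 ≤ i ≤ k and 0 ≤ j ≤ k: sin((i+1)π/(k+2)) · sin((j+1)π/(k+2)) = sin(π/(k+2)) · Σ_l sin((l+1)π/(k+2)), where the sum runs over all integers l with |i−j| ≤ l ≤ min(i+j, 2k−i−j) and l ≡ i+j (mod 2). -/

import Mathlib

open Real Finset

theorem aux_sum (t : ℝ) (a : ℤ) (n : ℕ) :
    2 * Real.sin t * ∑ l ∈ (Finset.Icc a (a + 2 * (n : ℤ))).filter
      (fun l => l % 2 = a % 2), Real.sin (((l : ℝ) + 1) * t) =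
    Real.cos ((a : ℝ) * t) - Real.cos (((a : ℝ) + 2 * n + 2) * t) := by
  have key : ∀ x : ℝ, 2 * Real.sin t * Real.sin ((x + 1) * t) =
      Real.cos (x * t) - Real.cos ((x + 2) * t) := by
    intro x
    have h1 : x * t = (x + 1) * t - t := by ring
    have h2 : (x + 2) * t = (x + 1) * t + t := by ring
    rw [h1, h2, Real.cos_sub, Real.cos_add]
    ring
  induction n with
  | zero =>
    have : (Finset.Icc a (a + 2 * ((0 : ℕ) : ℤ))).filter (fun l => l % 2 = a % 2) = {a} := by
      ext l
      simp only [Finset.mem_filter, Finset.mem_Icc, Finset.mem_singleton]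
      omega
    rw [this, Finset.sum_singleton, key]
    simp
  | succ n ih =>
    have : (Finset.Icc a (a + 2 * ((n + 1 : ℕ) : ℤ))).filter (fun l => l % 2 = a % 2) =
        insert (a + 2 * (n : ℤ) + 2)
          ((Finset.Icc a (a + 2 * (n : ℤ))).filter (fun l => l % 2 = a % 2)) := by
      ext l
      simp only [Finset.mem_filter, Finset.mem_Icc, Finset.mem_insert]
      omega
    rw [this, Finset.sum_insert, mul_add, ih, key]
    · push_cast
      ring_nf
    · simp only [Finset.mem_filter, Finset.mem_Icc]
      omega

/-- Multiplicativity of quantum dimensions under the level-`k` fusion rules of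
type `A₁⁽¹⁾`: for `1 ≤ k` and `0 ≤ i, j ≤ k`,
`sin((i+1)π/(k+2)) · sin((j+1)π/(k+2)) = sin(π/(k+2)) · Σ_l sin((l+1)π/(k+2))`,
where the sum is over integers `l` with `|i-j| ≤ l ≤ min(i+j, 2k-i-j)` and
`l ≡ i+j (mod 2)`. -/
theorem stmt5 (k i j : ℤ) (hk : 1 ≤ k) (hi0 : 0 ≤ i) (hik : i ≤ k)
    (hj0 : 0 ≤ j) (hjk : j ≤ k) :
    Real.sin (((i : ℝ) + 1) * Real.pi / ((k : ℝ) + 2)) *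
      Real.sin (((j : ℝ) + 1) * Real.pi / ((k : ℝ) + 2)) =
    Real.sin (Real.pi / ((k : ℝ) + 2)) *
      ∑ l ∈ (Finset.Icc (|i - j|) (min (i + j) (2 * k - i - j))).filter
          (fun l => l % 2 = (i + j) % 2),
        Real.sin (((l : ℝ) + 1) * Real.pi / ((k : ℝ) + 2)) := by
  have hk2 : (k : ℝ) + 2 ≠ 0 := by
    have : (1 : ℝ) ≤ k := by exact_mod_cast hk
    linarith
  obtain ⟨t, ht⟩ : ∃ t, t = Real.pi / ((k : ℝ) + 2) := ⟨_, rfl⟩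
  have hpi : ((k : ℝ) + 2) * t = Real.pi := by rw [ht]; field_simp
  simp only [mul_div_assoc, ← ht]
  obtain ⟨n, hn⟩ : ∃ n : ℕ, min (i + j) (2 * k - i - j) = |i - j| + 2 * (n : ℤ) := by
    refine ⟨((min (i + j) (2 * k - i - j) - |i - j|) / 2).toNat, ?_⟩
    rcases abs_cases (i - j) with h | h <;> omega
  have hpar : (i + j) % 2 = |i - j| % 2 := by
    rcases abs_cases (i - j) with h | h <;> omega
  have hs := aux_sum t |i - j| n
  have hc1 : Real.cos (((|i - j| : ℤ) : ℝ) * t) = Real.cos (((i : ℝ) - j) * t) := by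
    rcases abs_cases (i - j) with h | h
    · rw [h.1]; push_cast; rfl
    · rw [h.1, ← Real.cos_neg]; push_cast; ring_nf
  have hc2 : Real.cos ((((|i - j| : ℤ) : ℝ) + 2 * n + 2) * t) =
      Real.cos (((i : ℝ) + j + 2) * t) := by
    have hn' : ((|i - j| : ℤ) : ℝ) + 2 * n = ((min (i + j) (2 * k - i - j) : ℤ) : ℝ) := by
      rw [hn]; push_cast; rfl
    rw [hn']
    rcases min_choice (i + j) (2 * k - i - j) with h | h
    · rw [h]; push_cast; rfl
    · rw [h, ← Real.cos_two_pi_sub, ← hpi]; push_cast; ring_nf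
  rw [hc1, hc2] at hs
  rw [hn, hpar]
  have e1 : ((i : ℝ) - j) * t = ((i : ℝ) + 1) * t - ((j : ℝ) + 1) * t := by ring
  have e2 : ((i : ℝ) + j + 2) * t = ((i : ℝ) + 1) * t + ((j : ℝ) + 1) * t := by ring
  rw [e1, e2, Real.cos_sub, Real.cos_add] at hs
  linarith
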